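/- Let N be a positive integer and regard N-th order three-dimensional complex matrices as families A = (A_{ijk}) with i,j,k ∈ {1,…,N}. The trilinear ternary product defined by (A⊙B⊙C)_{ijk} = Σ_{l,m,n} A_{ijl} B_{nml} C_{mnk} is associative of the second kind: (A⊙B⊙C)⊙D⊙F = A⊙(D⊙C⊙B)⊙F = A⊙B⊙(C⊙D⊙F) for all three-dimensional matrices A, B, C, D, F of order N. -/

import Mathlib

open Finset

/-- Ternary product number 3 (in the sense of Abramov–Kerner–Liivapuu–Shitov) of
three-dimensional complex matrices of order `N`:
`(A ⊙ B ⊙ C)_{ijk} = A i j l * B n m l * C m n k` (summation over `l, m, n`). -/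
noncomputable def tprod3 {N : ℕ} (A B C : Fin N → Fin N → Fin N → ℂ) :
    Fin N → Fin N → Fin N → ℂ :=
  fun i j k => ∑ l, ∑ m, ∑ n, A i j l * B n m l * C m n k

/-- The matrix obtained by contracting the first two indices of `B` with those of `C`,
in swapped order. -/
noncomputable def contract {N : ℕ} (B C : Fin N → Fin N → Fin N → ℂ) :
    Matrix (Fin N) (Fin N) ℂ :=
  Matrix.of fun l k => ∑ m, ∑ n, B n m l * C m n k

/-- Right multiplication of every slice of a three-dimensional matrix by a matrix. -/
noncomputable def sliceMul {N : ℕ} (A : Fin N → Fin N → Fin N → ℂ)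
    (P : Matrix (Fin N) (Fin N) ℂ) : Fin N → Fin N → Fin N → ℂ :=
  fun i j k => ∑ l, A i j l * P l k

theorem tprod3_eq_sliceMul {N : ℕ} (A B C : Fin N → Fin N → Fin N → ℂ) :
    tprod3 A B C = sliceMul A (contract B C) := by
  ext i j k
  simp only [tprod3, sliceMul, contract, Matrix.of_apply, mul_sum, mul_assoc]

theorem sliceMul_sliceMul {N : ℕ} (A : Fin N → Fin N → Fin N → ℂ)
    (P Q : Matrix (Fin N) (Fin N) ℂ) :
    sliceMul (sliceMul A P) Q = sliceMul A (P * Q) := by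
  ext i j k
  simp only [sliceMul, Matrix.mul_apply, sum_mul, mul_sum, mul_assoc]
  exact sum_comm

theorem transpose_contract {N : ℕ} (B C : Fin N → Fin N → Fin N → ℂ) :
    (contract B C).transpose = contract C B := by
  ext l k
  simp only [contract, Matrix.transpose_apply, Matrix.of_apply]
  rw [sum_comm]
  simp only [mul_comm]

theorem contract_sliceMul_right {N : ℕ} (B C : Fin N → Fin N → Fin N → ℂ)
    (P : Matrix (Fin N) (Fin N) ℂ) :
    contract B (sliceMul C P) = contract B C * P := by
  ext l k
  simp only [contract, sliceMul, Matrix.mul_apply, Matrix.of_apply, sum_mul, mul_sum, mul_assoc]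
  calc
    _ = ∑ m, ∑ p, ∑ n, B n m l * (C m n p * P p k) := sum_congr rfl fun _ _ => sum_comm
    _ = _ := sum_comm

theorem contract_sliceMul_left {N : ℕ} (B C : Fin N → Fin N → Fin N → ℂ)
    (P : Matrix (Fin N) (Fin N) ℂ) :
    contract (sliceMul B P) C = P.transpose * contract B C := by
  rw [← transpose_contract C, contract_sliceMul_right, Matrix.transpose_mul, transpose_contract]

/-- this ternary product of three-dimensional matrices is associative
of the second kind. -/
theorem tprod_assoc_second_kind {N : ℕ} (hN : 0 < N)
    (A B C D F : Fin N → Fin N → Fin N → ℂ) :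
    tprod3 (tprod3 A B C) D F = tprod3 A (tprod3 D C B) F ∧
    tprod3 A (tprod3 D C B) F = tprod3 A B (tprod3 C D F) := by
  simp only [tprod3_eq_sliceMul, sliceMul_sliceMul, contract_sliceMul_left,
    contract_sliceMul_right, transpose_contract, and_self]
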